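/- arXiv:0807.1615 — 10 statements merged into one kernel-verified Lean document; each statement's English description precedes it below -/
import Mathlib

section
/- For any two matrices P, Q in SU(2), the traces p = tr(P), q = tr(Q), r = tr(PQ) are real numbers lying in [-2, 2] and satisfy the inequality p^2 + q^2 + r^2 - p*q*r - 4 ≤ 0. -/
open Matrix

/-- Every element of `SU(2)` is a unit quaternion in its standard matrix form. -/
theorem exists_eq_unit_quaternion_of_mem_specialUnitaryGroup_fin_two
    {P : Matrix (Fin 2) (Fin 2) ℂ} (hP : P ∈ Matrix.specialUnitaryGroup (Fin 2) ℂ) :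
    ∃ a b c d : ℝ, a ^ 2 + b ^ 2 + c ^ 2 + d ^ 2 = 1 ∧
      P = !![⟨a, b⟩, ⟨c, d⟩; ⟨-c, d⟩, ⟨a, -b⟩] := by
  obtain ⟨hU, hdet⟩ := Matrix.mem_specialUnitaryGroup_iff.mp hP
  have hstar : star P = P.adjugate := by
    calc star P = star P * (P * P.adjugate) := by rw [mul_adjugate, hdet, one_smul, mul_one]
      _ = P.adjugate := by rw [← mul_assoc, mem_unitaryGroup_iff'.mp hU, one_mul]
  have h₁ : star (P 0 0) = P 1 1 := by
    simpa [star_apply, adjugate_fin_two] using congrFun₂ hstar 0 0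
  have h₂ : star (P 0 1) = -P 1 0 := by
    simpa [star_apply, adjugate_fin_two] using congrFun₂ hstar 1 0
  rw [det_fin_two] at hdet
  simp only [Complex.ext_iff, Complex.star_def, Complex.conj_re, Complex.conj_im,
    Complex.neg_re, Complex.neg_im, Complex.sub_re, Complex.mul_re, Complex.one_re]
    at h₁ h₂ hdet
  have h₃ : (P 1 0).re = -(P 0 1).re := by linarith [h₂.1]
  have h₄ : (P 1 0).im = (P 0 1).im := by linarith [h₂.2]
  refine ⟨(P 0 0).re, (P 0 0).im, (P 0 1).re, (P 0 1).im, ?_, ?_⟩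
  · have := hdet.1
    rw [← h₁.1, ← h₁.2, h₃, h₄] at this
    linarith
  · ext i j
    fin_cases i <;> fin_cases j <;> simp [Complex.ext_iff, h₁.1, h₁.2, h₃, h₄]

/-- The trace of an element of `SU(2)` is real and lies in `[-2, 2]`. -/
theorem exists_trace_eq_of_mem_specialUnitaryGroup_fin_two
    {P : Matrix (Fin 2) (Fin 2) ℂ} (hP : P ∈ Matrix.specialUnitaryGroup (Fin 2) ℂ) :
    ∃ p : ℝ, P.trace = (p : ℂ) ∧ p ∈ Set.Icc (-2 : ℝ) 2 := by
  obtain ⟨a, b, c, d, h, rfl⟩ := exists_eq_unit_quaternion_of_mem_specialUnitaryGroup_fin_two hP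
  refine ⟨2 * a, ?_, ?_, ?_⟩
  · simp [trace_fin_two, Complex.ext_iff, two_mul]
  all_goals nlinarith [sq_nonneg b, sq_nonneg c, sq_nonneg d]

/-- For any two matrices `P, Q` in `SU(2)`, the traces `p = tr P`, `q = tr Q`, `r = tr (PQ)`
are real numbers lying in `[-2, 2]` and satisfy `p² + q² + r² - pqr - 4 ≤ 0`. -/
theorem su2_trace_triple_mem_fricke_body
    (P Q : Matrix (Fin 2) (Fin 2) ℂ)
    (hP : P ∈ Matrix.specialUnitaryGroup (Fin 2) ℂ)
    (hQ : Q ∈ Matrix.specialUnitaryGroup (Fin 2) ℂ) :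
    ∃ p q r : ℝ,
      P.trace = (p : ℂ) ∧ Q.trace = (q : ℂ) ∧ (P * Q).trace = (r : ℂ) ∧
      p ∈ Set.Icc (-2 : ℝ) 2 ∧ q ∈ Set.Icc (-2 : ℝ) 2 ∧ r ∈ Set.Icc (-2 : ℝ) 2 ∧
      p ^ 2 + q ^ 2 + r ^ 2 - p * q * r - 4 ≤ 0 := by
  obtain ⟨p, hp, hp'⟩ := exists_trace_eq_of_mem_specialUnitaryGroup_fin_two hP
  obtain ⟨q, hq, hq'⟩ := exists_trace_eq_of_mem_specialUnitaryGroup_fin_two hQ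
  obtain ⟨r, hr, hr'⟩ := exists_trace_eq_of_mem_specialUnitaryGroup_fin_two (mul_mem hP hQ)
  refine ⟨p, q, r, hp, hq, hr, hp', hq', hr', ?_⟩
  obtain ⟨a, b, c, d, h, rfl⟩ := exists_eq_unit_quaternion_of_mem_specialUnitaryGroup_fin_two hP
  obtain ⟨x, y, z, w, k, rfl⟩ := exists_eq_unit_quaternion_of_mem_specialUnitaryGroup_fin_two hQ
  have hp₂ : p = 2 * a := by
    have := congrArg Complex.re hp
    simp [trace_fin_two] at this
    linarith
  have hq₂ : q = 2 * x := by
    have := congrArg Complex.re hq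
    simp [trace_fin_two] at this
    linarith
  have hr₂ : r = 2 * (a * x - (b * y + c * z + d * w)) := by
    have := congrArg Complex.re hr
    simp [trace_fin_two] at this
    linarith
  have cauchy_schwarz : (b * y + c * z + d * w) ^ 2 ≤ (1 - a ^ 2) * (1 - x ^ 2) := by
    rw [show 1 - a ^ 2 = b ^ 2 + c ^ 2 + d ^ 2 by linarith,
      show 1 - x ^ 2 = y ^ 2 + z ^ 2 + w ^ 2 by linarith]
    linarith [sq_nonneg (b * z - c * y), sq_nonneg (b * w - d * y), sq_nonneg (c * w - d * z)]
  subst hp₂ hq₂ hr₂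
  linarith
end

section
/- For any real numbers p, q, r with p, q, r ∈ [-2, 2] and p^2 + q^2 + r^2 - p*q*r - 4 ≤ 0, there exist matrices P, Q in SU(2) such that tr(P) = p, tr(Q) = q, and tr(PQ) = r. -/
open Matrix

/-- A unit quaternion, written as a pair of complex numbers, gives an element of `SU(2)`. -/
theorem mem_specialUnitaryGroup_fin_two_of_normSq_add_normSq {z w : ℂ}
    (h : Complex.normSq z + Complex.normSq w = 1) :
    !![z, w; -star w, star z] ∈ Matrix.specialUnitaryGroup (Fin 2) ℂ := by
  have hzw : z * star z + w * star w = 1 := by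
    simp only [Complex.star_def, Complex.mul_conj]
    exact_mod_cast h
  rw [Matrix.mem_specialUnitaryGroup_iff, Matrix.mem_unitaryGroup_iff]
  constructor
  · ext i j
    fin_cases i <;> fin_cases j <;>
      simp [Matrix.mul_apply, Matrix.star_apply, Fin.sum_univ_two] at hzw ⊢ <;>
      first | ring1 | linear_combination hzw
  · rw [Matrix.det_fin_two_of]
    linear_combination hzw

/-- The inequality defining the Fricke body is the solvability condition for the coordinates of
a pair of unit quaternions `p / 2 + s i` and `q / 2 + b i + c j` whose product has real part
`r / 2`. -/
theorem exists_quaternion_coordinates_of_fricke_body {p q r : ℝ}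
    (hp : p ∈ Set.Icc (-2 : ℝ) 2) (hq : q ∈ Set.Icc (-2 : ℝ) 2)
    (h : p ^ 2 + q ^ 2 + r ^ 2 - p * q * r - 4 ≤ 0) :
    ∃ s b c : ℝ, (p / 2) ^ 2 + s ^ 2 = 1 ∧ (q / 2) ^ 2 + b ^ 2 + c ^ 2 = 1 ∧
      p * q / 2 - 2 * s * b = r := by
  have hs0 : 0 ≤ 1 - (p / 2) ^ 2 := by nlinarith [hp.1, hp.2]
  have hq0 : 0 ≤ 1 - (q / 2) ^ 2 := by nlinarith [hq.1, hq.2]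
  obtain ⟨s, hs⟩ : ∃ s : ℝ, s ^ 2 = 1 - (p / 2) ^ 2 := ⟨_, Real.sq_sqrt hs0⟩
  have key : (p * q / 2 - r) ^ 2 ≤ (2 * s) ^ 2 * (1 - (q / 2) ^ 2) := by
    rw [mul_pow, hs]
    linarith
  obtain ⟨b, hb, hbr⟩ : ∃ b : ℝ, b ^ 2 ≤ 1 - (q / 2) ^ 2 ∧ 2 * s * b = p * q / 2 - r := by
    rcases eq_or_ne s 0 with rfl | hs_ne
    · have : p * q / 2 - r = 0 := by
        apply pow_eq_zero_iff two_ne_zero |>.mp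
        exact le_antisymm (by simpa using key) (sq_nonneg _)
      exact ⟨0, by simpa using hq0, by simp [this]⟩
    · refine ⟨(p * q / 2 - r) / (2 * s), ?_, by field_simp⟩
      rw [div_pow, div_le_iff₀' (by positivity)]
      exact key
  refine ⟨s, b, √(1 - (q / 2) ^ 2 - b ^ 2), by linarith, ?_, by linarith⟩
  rw [Real.sq_sqrt (by linarith)]
  ring

/-- For any real numbers `p, q, r ∈ [-2, 2]` with `p² + q² + r² - pqr - 4 ≤ 0`, there exist
matrices `P, Q` in `SU(2)` such that `tr P = p`, `tr Q = q`, and `tr (PQ) = r`. -/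
theorem exists_su2_pair_of_fricke_body
    (p q r : ℝ)
    (hp : p ∈ Set.Icc (-2 : ℝ) 2) (hq : q ∈ Set.Icc (-2 : ℝ) 2) (hr : r ∈ Set.Icc (-2 : ℝ) 2)
    (h : p ^ 2 + q ^ 2 + r ^ 2 - p * q * r - 4 ≤ 0) :
    ∃ P Q : Matrix (Fin 2) (Fin 2) ℂ,
      P ∈ Matrix.specialUnitaryGroup (Fin 2) ℂ ∧
      Q ∈ Matrix.specialUnitaryGroup (Fin 2) ℂ ∧
      P.trace = (p : ℂ) ∧ Q.trace = (q : ℂ) ∧ (P * Q).trace = (r : ℂ) := by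
  obtain ⟨s, b, c, hs, hbc, hr'⟩ := exists_quaternion_coordinates_of_fricke_body hp hq h
  refine ⟨!![⟨p / 2, s⟩, 0; -star 0, star ⟨p / 2, s⟩],
    !![⟨q / 2, b⟩, (c : ℂ); -star (c : ℂ), star ⟨q / 2, b⟩],
    mem_specialUnitaryGroup_fin_two_of_normSq_add_normSq ?_,
    mem_specialUnitaryGroup_fin_two_of_normSq_add_normSq ?_, ?_, ?_, ?_⟩
  · simp only [Complex.normSq_mk, map_zero]
    linarith
  · simp only [Complex.normSq_mk, Complex.normSq_ofReal]
    linarith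
  · apply Complex.ext <;> simp [Matrix.trace_fin_two]
  · apply Complex.ext <;> simp [Matrix.trace_fin_two]
  · apply Complex.ext <;> simp [Matrix.trace_fin_two] <;> linarith
end

section
/- If P, Q, P', Q' are matrices in SU(2) with tr(P) = tr(P'), tr(Q) = tr(Q'), and tr(PQ) = tr(P'Q'), then there exists g ∈ SU(2) such that P' = g P g⁻¹ and Q' = g Q g⁻¹. -/
open Matrix

namespace SU2

open ComplexConjugate

local notation "SU₂" => Matrix.specialUnitaryGroup (Fin 2) ℂ
local notation "M₂" => Matrix (Fin 2) (Fin 2) ℂ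

/-- The matrix of the quaternion `a + b j`. -/
def quat (a b : ℂ) : M₂ := !![a, b; -conj b, conj a]

lemma quat_mul (a b c d : ℂ) :
    quat a b * quat c d = quat (a * c - b * conj d) (a * d + b * conj c) := by
  ext i j
  fin_cases i <;> fin_cases j <;> simp [quat] <;> ring

lemma quat_mem {a b : ℂ} (h : Complex.normSq a + Complex.normSq b = 1) : quat a b ∈ SU₂ := by
  have h' : a * conj a + b * conj b = 1 := by
    rw [Complex.mul_conj, Complex.mul_conj]
    exact_mod_cast h
  rw [mem_specialUnitaryGroup_iff, mem_unitaryGroup_iff]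
  constructor
  · ext i j
    fin_cases i <;> fin_cases j <;>
      simp [quat, star_eq_conjTranspose, Matrix.mul_apply] <;>
      first | ring1 | linear_combination h'
  · simp only [quat, det_fin_two_of]
    linear_combination h'

lemma exists_eq_quat (P : SU₂) :
    ∃ a b, Complex.normSq a + Complex.normSq b = 1 ∧ (P : M₂) = quat a b := by
  obtain ⟨P, hP⟩ := P
  obtain ⟨hU, hdet⟩ := mem_specialUnitaryGroup_iff.1 hP
  have hinv : star P = P.adjugate := by
    calc star P = star P * (P * P.adjugate) := by rw [mul_adjugate, hdet, one_smul, mul_one]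
      _ = P.adjugate := by rw [← mul_assoc, mem_unitaryGroup_iff'.1 hU, one_mul]
  have h00 : conj (P 0 0) = P 1 1 := by
    simpa [star_eq_conjTranspose, adjugate_fin_two] using congrFun (congrFun hinv 0) 0
  have h10 : conj (P 0 1) = -P 1 0 := by
    simpa [star_eq_conjTranspose, adjugate_fin_two] using congrFun (congrFun hinv 1) 0
  refine ⟨P 0 0, P 0 1, ?_, ?_⟩
  · rw [det_fin_two, ← h00, ← neg_eq_iff_eq_neg.2 h10, mul_neg, sub_neg_eq_add,
      Complex.mul_conj, Complex.mul_conj] at hdet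
    exact_mod_cast hdet
  · ext i j
    fin_cases i <;> fin_cases j <;> simp [quat, h00, h10]

lemma trace_quat (a b : ℂ) : (quat a b).trace = (2 * a.re : ℝ) := by
  rw [quat, trace_fin_two_of, Complex.add_conj]

lemma trace_conj (g P : SU₂) :
    ((g * P * g⁻¹ : SU₂) : M₂).trace = (P : M₂).trace := by
  rw [Submonoid.coe_mul, trace_mul_comm, ← Submonoid.coe_mul]
  congr 2
  group

/-- A nonzero quaternion intertwining two elements of `SU(2)` rescales to an element of `SU(2)`
conjugating one to the other. -/
lemma isConj_of_quat_mul {P D : SU₂} {x y : ℂ} (hxy : Complex.normSq x + Complex.normSq y ≠ 0)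
    (h : quat x y * P = D * quat x y) : IsConj P D := by
  set n := Complex.normSq x + Complex.normSq y
  have hn : 0 < n := lt_of_le_of_ne
    (add_nonneg (Complex.normSq_nonneg _) (Complex.normSq_nonneg _)) hxy.symm
  set r : ℝ := (√n)⁻¹
  have hr : r * r * n = 1 := by
    rw [← mul_inv, Real.mul_self_sqrt hn.le, inv_mul_cancel₀ hn.ne']
  have hsmul : quat (r * x) (r * y) = (r : ℂ) • quat x y := by
    ext i j
    fin_cases i <;> fin_cases j <;> simp [quat]
  have hmem : Complex.normSq (r * x) + Complex.normSq (r * y) = 1 := by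
    rw [Complex.normSq_mul, Complex.normSq_mul, Complex.normSq_ofReal, ← mul_add, hr]
  refine isConj_iff.2 ⟨⟨_, quat_mem hmem⟩, ?_⟩
  rw [mul_inv_eq_iff_eq_mul]
  apply Subtype.ext
  rw [Submonoid.coe_mul, Submonoid.coe_mul]
  simp only [hsmul, smul_mul_assoc, mul_smul_comm, h]

lemma exists_isConj_diagonal (P : SU₂) :
    ∃ (D : SU₂) (z : ℂ), IsConj P D ∧ (D : M₂) = quat z 0 ∧
      0 ≤ z.im ∧ Complex.normSq z = 1 := by
  obtain ⟨a, b, hab, hP⟩ := exists_eq_quat P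
  set s := √(a.im ^ 2 + Complex.normSq b)
  have hs : s * s = a.im ^ 2 + Complex.normSq b :=
    Real.mul_self_sqrt (add_nonneg (sq_nonneg _) (Complex.normSq_nonneg _))
  have hz : Complex.normSq ⟨a.re, s⟩ = 1 := by
    rw [Complex.normSq_mk, hs, ← hab, Complex.normSq_apply a]
    ring
  have hz' : Complex.normSq (⟨a.re, s⟩ : ℂ) + Complex.normSq 0 = 1 := by simpa using hz
  refine ⟨⟨_, quat_mem hz'⟩, ⟨a.re, s⟩, ?_, rfl, Real.sqrt_nonneg _, hz⟩
  by_cases hb : b = 0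
  · by_cases ha : 0 ≤ a.im
    · have : s = a.im := by simp [s, hb, Real.sqrt_sq ha]
      refine isConj_of_quat_mul (x := 1) (y := 0) (by simp) ?_
      simp only [hP, this, hb, quat_mul]
      simp
    · have : s = -a.im := by
        simp only [s, hb, map_zero, add_zero, Real.sqrt_sq_eq_abs, abs_of_neg (not_le.1 ha)]
      refine isConj_of_quat_mul (x := 0) (y := 1) (by simp) ?_
      simp only [hP, this, hb, quat_mul]
      congr 1
      · simp
      · apply Complex.ext <;> simp
  · have hb' := Complex.normSq_pos.2 hb
    refine isConj_of_quat_mul (x := conj b) (y := conj (⟨a.re, s⟩ - a)) ?_ ?_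
    · rw [Complex.normSq_conj]
      exact (add_pos_of_pos_of_nonneg hb' (Complex.normSq_nonneg _)).ne'
    · rw [Complex.normSq_apply] at hs
      simp only [hP, quat_mul]
      congr 1 <;> apply Complex.ext <;> simp <;> linarith

theorem isConj_of_trace_eq {P P' : SU₂}
    (h : (P : M₂).trace = (P' : M₂).trace) : IsConj P P' := by
  obtain ⟨D, z, hPD, hD, hz, hz1⟩ := exists_isConj_diagonal P
  obtain ⟨D', z', hPD', hD', hz', hz1'⟩ := exists_isConj_diagonal P'
  suffices D = D' by
    subst this
    exact hPD.trans hPD'.symm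
  obtain ⟨g, rfl⟩ := isConj_iff.1 hPD
  obtain ⟨g', rfl⟩ := isConj_iff.1 hPD'
  rw [← trace_conj g, ← trace_conj g' P', hD, hD', trace_quat, trace_quat,
    Complex.ofReal_inj] at h
  have hre : z.re = z'.re := by linarith
  have him : z.im = z'.im := by
    rw [Complex.normSq_apply] at hz1 hz1'
    rw [hre] at hz1
    nlinarith
  apply Subtype.ext
  rw [hD, hD', Complex.ext hre him]

lemma exists_commute_conj {D Q Q' : SU₂} {z : ℂ} (hD : (D : M₂) = quat z 0)
    (h : (Q : M₂).trace = (Q' : M₂).trace)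
    (hDQ : ((D * Q : SU₂) : M₂).trace = ((D * Q' : SU₂) : M₂).trace) :
    ∃ g : SU₂, g * D = D * g ∧ g * Q * g⁻¹ = Q' := by
  by_cases hz : z.im = 0
  · obtain ⟨g, hg⟩ := isConj_iff.1 (isConj_of_trace_eq h)
    refine ⟨g, ?_, hg⟩
    obtain ⟨a, b, -, hab⟩ := exists_eq_quat g
    have hzc : conj z = z := Complex.conj_eq_iff_im.2 hz
    apply Subtype.ext
    rw [Submonoid.coe_mul, Submonoid.coe_mul, hD, hab, quat_mul, quat_mul, hzc]
    congr 1 <;> simp [mul_comm]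
  · obtain ⟨a, b, hab, hQ⟩ := exists_eq_quat Q
    obtain ⟨a', b', hab', hQ'⟩ := exists_eq_quat Q'
    rw [Submonoid.coe_mul, Submonoid.coe_mul, hD, hQ, hQ', quat_mul, quat_mul, trace_quat,
      trace_quat, Complex.ofReal_inj] at hDQ
    rw [hQ, hQ', trace_quat, trace_quat, Complex.ofReal_inj] at h
    have hre : a.re = a'.re := by linarith
    have him : a.im = a'.im := by
      simp [hre] at hDQ
      exact hDQ.resolve_right hz
    obtain rfl : a = a' := Complex.ext hre him
    have hbb : Complex.normSq b = Complex.normSq b' := by linarith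
    obtain ⟨w, hw, hwb⟩ : ∃ w : ℂ, Complex.normSq w = 1 ∧ w * b = b' * conj w := by
      by_cases hb : b = 0
      · have hb' : b' = 0 := by simpa [hb] using hbb.symm
        exact ⟨1, by simp, by simp [hb, hb']⟩
      · obtain ⟨w, hw⟩ := IsAlgClosed.exists_pow_nat_eq (b' / b) (n := 2) two_pos
        have hw1 : Complex.normSq w = 1 := by
          have := congrArg Complex.normSq hw
          rw [map_pow, map_div₀, hbb,
            div_self (hbb ▸ (Complex.normSq_pos.2 hb).ne')] at this
          exact (pow_eq_one_iff_of_nonneg (Complex.normSq_nonneg _) two_ne_zero).1 this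
        have hww : w * conj w = 1 := by rw [Complex.mul_conj, hw1, Complex.ofReal_one]
        rw [eq_div_iff hb] at hw
        exact ⟨w, hw1, by linear_combination conj w * hw - w * b * hww⟩
    have hw0 : Complex.normSq w + Complex.normSq 0 = 1 := by simpa using hw
    refine ⟨⟨_, quat_mem hw0⟩, ?_, ?_⟩
    · apply Subtype.ext
      simp only [Submonoid.coe_mul, hD, quat_mul]
      congr 1 <;> simp [mul_comm]
    · rw [mul_inv_eq_iff_eq_mul]
      apply Subtype.ext
      simp only [Submonoid.coe_mul, hQ, hQ', quat_mul]
      congr 1 <;> simp [mul_comm]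
      linear_combination hwb

theorem exists_conj_pair {P Q P' Q' : SU₂}
    (hP : (P : M₂).trace = (P' : M₂).trace)
    (hQ : (Q : M₂).trace = (Q' : M₂).trace)
    (hPQ : ((P * Q : SU₂) : M₂).trace = ((P' * Q' : SU₂) : M₂).trace) :
    ∃ g : SU₂, P' = g * P * g⁻¹ ∧ Q' = g * Q * g⁻¹ := by
  obtain ⟨D, z, hPD, hD, -, -⟩ := exists_isConj_diagonal P
  obtain ⟨c', hc'⟩ := isConj_iff.1 ((isConj_of_trace_eq hP).symm.trans hPD)
  obtain ⟨c, hc⟩ := isConj_iff.1 hPD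
  obtain ⟨g, hgD, hgQ⟩ := exists_commute_conj (D := D) (Q := c * Q * c⁻¹)
    (Q' := c' * Q' * c'⁻¹) hD (by rw [trace_conj, trace_conj, hQ]) (by
      have h : D * (c * Q * c⁻¹) = c * (P * Q) * c⁻¹ := by rw [← hc]; group
      have h' : D * (c' * Q' * c'⁻¹) = c' * (P' * Q') * c'⁻¹ := by rw [← hc']; group
      rw [h, h', trace_conj, trace_conj, hPQ])
  refine ⟨c'⁻¹ * g * c, ?_, ?_⟩
  · calc P' = c'⁻¹ * (c' * P' * c'⁻¹) * c' := by group
      _ = c'⁻¹ * (g * D * g⁻¹) * c' := by rw [hc', hgD, mul_inv_cancel_right]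
      _ = c'⁻¹ * g * c * P * (c'⁻¹ * g * c)⁻¹ := by rw [← hc]; group
  · calc Q' = c'⁻¹ * (c' * Q' * c'⁻¹) * c' := by group
      _ = c'⁻¹ * g * c * Q * (c'⁻¹ * g * c)⁻¹ := by rw [← hgQ]; group

lemma coe_inv (g : SU₂) : ((g⁻¹ : SU₂) : M₂) = (g : M₂)⁻¹ := by
  refine (Matrix.inv_eq_right_inv ?_).symm
  rw [← Submonoid.coe_mul, mul_inv_cancel, Submonoid.coe_one]

end SU2

/-- A pair of `SU(2)` matrices is determined up to simultaneous `SU(2)`-conjugation by its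
trace triple `(tr P, tr Q, tr PQ)`. -/
theorem su2_pair_conj_of_trace_eq
    (P Q P' Q' : Matrix (Fin 2) (Fin 2) ℂ)
    (hP : P ∈ Matrix.specialUnitaryGroup (Fin 2) ℂ)
    (hQ : Q ∈ Matrix.specialUnitaryGroup (Fin 2) ℂ)
    (hP' : P' ∈ Matrix.specialUnitaryGroup (Fin 2) ℂ)
    (hQ' : Q' ∈ Matrix.specialUnitaryGroup (Fin 2) ℂ)
    (h1 : P.trace = P'.trace) (h2 : Q.trace = Q'.trace)
    (h3 : (P * Q).trace = (P' * Q').trace) :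
    ∃ g ∈ Matrix.specialUnitaryGroup (Fin 2) ℂ,
      P' = g * P * g⁻¹ ∧ Q' = g * Q * g⁻¹ := by
  obtain ⟨g, hgP, hgQ⟩ := SU2.exists_conj_pair (P := ⟨P, hP⟩) (Q := ⟨Q, hQ⟩)
    (P' := ⟨P', hP'⟩) (Q' := ⟨Q', hQ'⟩) h1 h2 h3
  refine ⟨g, g.2, ?_, ?_⟩
  · simpa [SU2.coe_inv] using congrArg Subtype.val hgP
  · simpa [SU2.coe_inv] using congrArg Subtype.val hgQ
end

section
/- For any matrices A, B, C in SU(2), the seven trace coordinates a = tr(A), b = tr(B), c = tr(C), x = tr(AB), y = tr(BC), z = tr(CA), d = tr(ABC) satisfy the Fricke relation a² + b² + c² + d² + x² + y² + z² - ((ab + cd)x + (bc + da)y + (ca + bd)z) + xyz + abcd - 4 = 0. -/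
open Matrix

/-- The Fricke relation for `2 × 2` matrices over a commutative ring, homogenized by the
determinants. -/
theorem fricke_relation_homogeneous {R : Type*} [CommRing R] (A B C : Matrix (Fin 2) (Fin 2) R) :
    A.trace ^ 2 * (B.det * C.det) + B.trace ^ 2 * (A.det * C.det) + C.trace ^ 2 * (A.det * B.det)
      + (A * B * C).trace ^ 2 + (A * B).trace ^ 2 * C.det + (B * C).trace ^ 2 * A.det
      + (C * A).trace ^ 2 * B.det
      - ((A.trace * B.trace * C.det + C.trace * (A * B * C).trace) * (A * B).trace
        + (B.trace * C.trace * A.det + (A * B * C).trace * A.trace) * (B * C).trace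
        + (C.trace * A.trace * B.det + B.trace * (A * B * C).trace) * (C * A).trace)
      + (A * B).trace * (B * C).trace * (C * A).trace
      + A.trace * B.trace * C.trace * (A * B * C).trace - 4 * (A.det * B.det * C.det) = 0 := by
  simp only [trace_fin_two, det_fin_two, mul_apply, Fin.sum_univ_two]
  ring

/-- The seven trace coordinates of any triple `A, B, C ∈ SU(2)` satisfy the Fricke relation. -/
theorem su2_fricke_relation
    (A B C : Matrix (Fin 2) (Fin 2) ℂ)
    (hA : A ∈ Matrix.specialUnitaryGroup (Fin 2) ℂ)
    (hB : B ∈ Matrix.specialUnitaryGroup (Fin 2) ℂ)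
    (hC : C ∈ Matrix.specialUnitaryGroup (Fin 2) ℂ)
    (a b c x y z d : ℂ)
    (ha : a = A.trace) (hb : b = B.trace) (hc : c = C.trace)
    (hx : x = (A * B).trace) (hy : y = (B * C).trace) (hz : z = (C * A).trace)
    (hd : d = (A * B * C).trace) :
    a ^ 2 + b ^ 2 + c ^ 2 + d ^ 2 + x ^ 2 + y ^ 2 + z ^ 2
      - ((a * b + c * d) * x + (b * c + d * a) * y + (c * a + b * d) * z)
      + x * y * z + a * b * c * d - 4 = 0 := by
  have h := fricke_relation_homogeneous A B C
  rw [(mem_specialUnitaryGroup_iff.mp hA).2, (mem_specialUnitaryGroup_iff.mp hB).2,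
    (mem_specialUnitaryGroup_iff.mp hC).2] at h
  subst ha hb hc hx hy hz hd
  simpa only [mul_one] using h
end

section
/- For any matrices A, B, C in SU(2), with trace coordinates a = tr(A), b = tr(B), c = tr(C), x = tr(AB), y = tr(BC), z = tr(CA), d = tr(ABC), one has tr(A²B²C) = a·d·b - a·z - b·y + c. -/
open Matrix

/-- The Cayley–Hamilton identity for a `2 × 2` matrix of determinant one. -/
theorem Matrix.sq_eq_trace_smul_sub_one_of_det_eq_one {R : Type*} [CommRing R]
    {M : Matrix (Fin 2) (Fin 2) R} (hM : M.det = 1) : M ^ 2 = M.trace • M - 1 := by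
  rw [Matrix.det_fin_two] at hM
  ext i j
  fin_cases i <;> fin_cases j <;>
    simp [sq, Matrix.mul_apply, Fin.sum_univ_two, Matrix.trace_fin_two] <;>
    grind

/-- For `A, B, C ∈ SU(2)` with trace coordinates `a, b, c, x, y, z, d`,
`tr(A²B²C) = adb - az - by + c`. -/
theorem su2_trace_A2B2C
    (A B C : Matrix (Fin 2) (Fin 2) ℂ)
    (hA : A ∈ Matrix.specialUnitaryGroup (Fin 2) ℂ)
    (hB : B ∈ Matrix.specialUnitaryGroup (Fin 2) ℂ)
    (hC : C ∈ Matrix.specialUnitaryGroup (Fin 2) ℂ)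
    (a b c x y z d : ℂ)
    (ha : a = A.trace) (hb : b = B.trace) (hc : c = C.trace)
    (hx : x = (A * B).trace) (hy : y = (B * C).trace) (hz : z = (C * A).trace)
    (hd : d = (A * B * C).trace) :
    (A ^ 2 * B ^ 2 * C).trace = a * d * b - a * z - b * y + c := by
  rw [Matrix.mem_specialUnitaryGroup_iff] at hA hB
  subst ha hb hc hy hz hd
  have expand : A ^ 2 * B ^ 2 * C = (A.trace * B.trace) • (A * B * C) -
      A.trace • (A * C) - B.trace • (B * C) + C := by
    rw [Matrix.sq_eq_trace_smul_sub_one_of_det_eq_one hA.2,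
      Matrix.sq_eq_trace_smul_sub_one_of_det_eq_one hB.2]
    simp only [sub_mul, mul_sub, smul_mul_assoc, mul_smul_comm, one_mul, mul_one]
    module
  rw [expand]
  simp only [Matrix.trace_add, Matrix.trace_sub, Matrix.trace_smul, smul_eq_mul,
    Matrix.trace_mul_comm C A]
  ring
end

section
/- For any matrices A, B, C in SU(2), with trace coordinates a = tr(A), b = tr(B), c = tr(C), x = tr(AB), y = tr(BC), z = tr(CA), d = tr(ABC), one has tr(A·B²·C·B·C⁻¹·B⁻²) = b²xy² + b²yz - b³dy - aby² + b²cd + c²x - 2bcxy + 2bdy - bcz + acy - yz - cd + ab - x. -/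
open Matrix

/-- The homogeneous form of the trace identity, valid for all `2 × 2` matrices over a commutative
ring, with inverses replaced by adjugates. -/
theorem trace_mul_sq_mul_conj_adjugate {R : Type*} [CommRing R] (A B C : Matrix (Fin 2) (Fin 2) R) :
    (A * B ^ 2 * C * B * C.adjugate * B.adjugate ^ 2).trace =
      B.trace ^ 2 * (A * B).trace * (B * C).trace ^ 2
        + B.det * B.trace ^ 2 * (B * C).trace * (C * A).trace
        - B.trace ^ 3 * (A * B * C).trace * (B * C).trace
        - B.det * A.trace * B.trace * (B * C).trace ^ 2
        + B.det * B.trace ^ 2 * C.trace * (A * B * C).trace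
        + B.det ^ 2 * C.trace ^ 2 * (A * B).trace
        - 2 * B.det * B.trace * C.trace * (A * B).trace * (B * C).trace
        + 2 * B.det * B.trace * (A * B * C).trace * (B * C).trace
        - B.det ^ 2 * B.trace * C.trace * (C * A).trace
        + B.det ^ 2 * A.trace * C.trace * (B * C).trace
        - B.det ^ 2 * (B * C).trace * (C * A).trace
        - B.det ^ 2 * C.trace * (A * B * C).trace
        + B.det ^ 2 * C.det * A.trace * B.trace
        - B.det ^ 2 * C.det * (A * B).trace := by
  rw [eta_fin_two A, eta_fin_two B, eta_fin_two C]
  simp only [pow_two !![_, _; _, _], adjugate_fin_two_of, det_fin_two_of, trace_fin_two_of,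
    mul_fin_two]
  ring

/-- The action of the Dehn twist about `U = B²C` on the coordinate `x`:
`tr(AB²CBC⁻¹B⁻²) = b²xy² + b²yz - b³dy - aby² + b²cd + c²x - 2bcxy + 2bdy - bcz + acy
  - yz - cd + ab - x`. -/
theorem su2_trace_twist_U_on_x
    (A B C : Matrix (Fin 2) (Fin 2) ℂ)
    (hA : A ∈ Matrix.specialUnitaryGroup (Fin 2) ℂ)
    (hB : B ∈ Matrix.specialUnitaryGroup (Fin 2) ℂ)
    (hC : C ∈ Matrix.specialUnitaryGroup (Fin 2) ℂ)
    (a b c x y z d : ℂ)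
    (ha : a = A.trace) (hb : b = B.trace) (hc : c = C.trace)
    (hx : x = (A * B).trace) (hy : y = (B * C).trace) (hz : z = (C * A).trace)
    (hd : d = (A * B * C).trace) :
    (A * B ^ 2 * C * B * C⁻¹ * B⁻¹ ^ 2).trace =
      b ^ 2 * x * y ^ 2 + b ^ 2 * y * z - b ^ 3 * d * y - a * b * y ^ 2
        + b ^ 2 * c * d + c ^ 2 * x - 2 * b * c * x * y + 2 * b * d * y
        - b * c * z + a * c * y - y * z - c * d + a * b - x := by
  have hB' : B.det = 1 := (mem_specialUnitaryGroup_iff.mp hB).2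
  have hC' : C.det = 1 := (mem_specialUnitaryGroup_iff.mp hC).2
  have key := trace_mul_sq_mul_conj_adjugate A B C
  rw [hB', hC'] at key
  rw [inv_def, inv_def, hB', hC', Ring.inverse_one, one_smul, one_smul, key, ha, hb, hc, hx, hy,
    hz, hd]
  ring
end

section
/- For any matrices A, B, C in SU(2), with trace coordinates a = tr(A), b = tr(B), c = tr(C), x = tr(AB), y = tr(BC), z = tr(CA), d = tr(ABC), one has tr(A·B²·C·B⁻¹) = b²d - bxy - bz + cx + ay - d. -/
open Matrix

/-- The trace of `AB²C adj(B)` for arbitrary `2 × 2` matrices over a commutative ring. -/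
theorem Matrix.trace_mul_sq_mul_mul_adjugate_fin_two {R : Type*} [CommRing R]
    (A B C : Matrix (Fin 2) (Fin 2) R) :
    (A * B ^ 2 * C * B.adjugate).trace =
      B.trace ^ 2 * (A * B * C).trace - B.trace * (A * B).trace * (B * C).trace +
        B.det * (C.trace * (A * B).trace + A.trace * (B * C).trace -
          B.trace * (C * A).trace - (A * B * C).trace) := by
  simp only [pow_two, Matrix.trace_fin_two, Matrix.det_fin_two, Matrix.adjugate_fin_two,
    Matrix.mul_apply, Fin.sum_univ_two, Matrix.of_apply, Matrix.cons_val_zero,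
    Matrix.cons_val_one, Matrix.cons_val', Matrix.cons_val_fin_one]
  ring

/-- The action of the Dehn twist about `U = B²C` on the coordinate `d`:
`tr(AB²CB⁻¹) = b²d - bxy - bz + cx + ay - d`. -/
theorem su2_trace_twist_U_on_d
    (A B C : Matrix (Fin 2) (Fin 2) ℂ)
    (hA : A ∈ Matrix.specialUnitaryGroup (Fin 2) ℂ)
    (hB : B ∈ Matrix.specialUnitaryGroup (Fin 2) ℂ)
    (hC : C ∈ Matrix.specialUnitaryGroup (Fin 2) ℂ)
    (a b c x y z d : ℂ)
    (ha : a = A.trace) (hb : b = B.trace) (hc : c = C.trace)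
    (hx : x = (A * B).trace) (hy : y = (B * C).trace) (hz : z = (C * A).trace)
    (hd : d = (A * B * C).trace) :
    (A * B ^ 2 * C * B⁻¹).trace =
      b ^ 2 * d - b * x * y - b * z + c * x + a * y - d := by
  have hdet : B.det = 1 := (Matrix.mem_specialUnitaryGroup_iff.mp hB).2
  have hinv : B⁻¹ = B.adjugate := by rw [Matrix.inv_def, hdet, Ring.inverse_one, one_smul]
  rw [hinv, Matrix.trace_mul_sq_mul_mul_adjugate_fin_two, hdet, ha, hb, hc, hx, hy, hz, hd]
  ring
end

section
/- For any matrices A, B, C in SU(2), with trace coordinates a = tr(A), b = tr(B), c = tr(C), x = tr(AB), z = tr(CA), d = tr(ABC), and k = tr(A²BC), one has tr(A²·B·A⁻¹·C) = a·k - a·x·z + c·x + b·z - d. -/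
open Matrix

namespace Matrix

variable {R : Type*} [CommRing R]

theorem adjugate_fin_two_eq_trace_smul_sub (A : Matrix (Fin 2) (Fin 2) R) :
    A.adjugate = A.trace • 1 - A := by
  ext i j
  fin_cases i <;> fin_cases j <;> simp [adjugate_fin_two, trace_fin_two]

theorem sq_fin_two_eq_trace_smul_sub (A : Matrix (Fin 2) (Fin 2) R) :
    A ^ 2 = A.trace • A - A.det • 1 := by
  have h := A.mul_adjugate
  rw [adjugate_fin_two_eq_trace_smul_sub, mul_sub, mul_smul_comm, mul_one, ← sq] at h
  rw [← h, sub_sub_cancel]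

theorem trace_mul_mul_add_trace_mul_mul_swap (A B C : Matrix (Fin 2) (Fin 2) R) :
    (A * B * C).trace + (B * A * C).trace =
      A.trace * (B * C).trace + B.trace * (C * A).trace + C.trace * (A * B).trace
        - A.trace * B.trace * C.trace := by
  simp only [trace_fin_two, mul_apply, Fin.sum_univ_two]
  ring

theorem trace_mul_mul_mul_self (A B C : Matrix (Fin 2) (Fin 2) R) :
    (A * B * A * C).trace =
      (A * B).trace * (C * A).trace - A.det * (B.trace * C.trace - (B * C).trace) := by
  simp only [trace_fin_two, det_fin_two, mul_apply, Fin.sum_univ_two]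
  ring

end Matrix

/-- The action of the Dehn twist about `T = A²B` on the coordinate `d`:
`tr(A²BA⁻¹C) = ak - axz + cx + bz - d`, where `k = tr (A²BC)`. -/
theorem su2_trace_twist_T_on_d
    (A B C : Matrix (Fin 2) (Fin 2) ℂ)
    (hA : A ∈ Matrix.specialUnitaryGroup (Fin 2) ℂ)
    (hB : B ∈ Matrix.specialUnitaryGroup (Fin 2) ℂ)
    (hC : C ∈ Matrix.specialUnitaryGroup (Fin 2) ℂ)
    (a b c x z d k : ℂ)
    (ha : a = A.trace) (hb : b = B.trace) (hc : c = C.trace)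
    (hx : x = (A * B).trace) (hz : z = (C * A).trace)
    (hd : d = (A * B * C).trace) (hk : k = (A ^ 2 * B * C).trace) :
    (A ^ 2 * B * A⁻¹ * C).trace =
      a * k - a * x * z + c * x + b * z - d := by
  subst ha hb hc hx hz hd hk
  have hdet : A.det = 1 := (mem_specialUnitaryGroup_iff.mp hA).2
  have hinv : A⁻¹ = A.trace • 1 - A := by
    rw [inv_def, hdet, Ring.inverse_one, one_smul, adjugate_fin_two_eq_trace_smul_sub]
  have hexpand : (A ^ 2 * B * A⁻¹ * C).trace =
      A.trace * (A ^ 2 * B * C).trace - (A ^ 2 * B * A * C).trace := by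
    simp [hinv, mul_sub, sub_mul]
  have hsq : (A ^ 2 * B * A * C).trace =
      A.trace * (A * B * A * C).trace - (B * A * C).trace := by
    simp [sq_fin_two_eq_trace_smul_sub, hdet, sub_mul]
  rw [hexpand, hsq, trace_mul_mul_mul_self, hdet]
  linear_combination trace_mul_mul_add_trace_mul_mul_swap A B C
end

section
/- For any matrices A, B, C in SU(2), with trace coordinates a = tr(A), b = tr(B), c = tr(C), x = tr(AB), y = tr(BC), z = tr(CA), d = tr(ABC), one has tr(A⁻¹·C⁻²·B·C²·A²) = c³d - c²yz - c²x - 2cd + cbz + cay + x. -/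
open Matrix

/-- The trace of `adj(C)² B C² A`, for arbitrary `2 × 2` matrices, as a polynomial in traces and
in the determinant of `C`. -/
theorem trace_adjugate_sq_mul_mul_sq_mul {R : Type*} [CommRing R]
    (A B C : Matrix (Fin 2) (Fin 2) R) :
    (C.adjugate ^ 2 * B * C ^ 2 * A).trace =
      C.trace ^ 3 * (A * B * C).trace - C.trace ^ 2 * (B * C).trace * (C * A).trace
        + C.det * (C.trace * B.trace * (C * A).trace + C.trace * A.trace * (B * C).trace
          - C.trace ^ 2 * (A * B).trace - 2 * C.trace * (A * B * C).trace)
        + C.det ^ 2 * (A * B).trace := by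
  simp only [adjugate_fin_two, det_fin_two, trace_fin_two, pow_two, mul_apply, Fin.sum_univ_two,
    of_apply, cons_val', cons_val_zero, cons_val_one, cons_val_fin_one]
  ring

/-- The action of the Dehn twist about `U = A²C²` on the coordinate `x`:
`tr(A⁻¹C⁻²BC²A²) = c³d - c²yz - c²x - 2cd + cbz + cay + x`. -/
theorem su2_trace_twist_A2C2_on_x
    (A B C : Matrix (Fin 2) (Fin 2) ℂ)
    (hA : A ∈ Matrix.specialUnitaryGroup (Fin 2) ℂ)
    (hB : B ∈ Matrix.specialUnitaryGroup (Fin 2) ℂ)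
    (hC : C ∈ Matrix.specialUnitaryGroup (Fin 2) ℂ)
    (a b c x y z d : ℂ)
    (ha : a = A.trace) (hb : b = B.trace) (hc : c = C.trace)
    (hx : x = (A * B).trace) (hy : y = (B * C).trace) (hz : z = (C * A).trace)
    (hd : d = (A * B * C).trace) :
    (A⁻¹ * C⁻¹ ^ 2 * B * C ^ 2 * A ^ 2).trace =
      c ^ 3 * d - c ^ 2 * y * z - c ^ 2 * x - 2 * c * d + c * b * z
        + c * a * y + x := by
  have hA_det : A.det = 1 := (mem_specialUnitaryGroup_iff.mp hA).2
  have hC_det : C.det = 1 := (mem_specialUnitaryGroup_iff.mp hC).2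
  have hC_inv : C⁻¹ = C.adjugate := by simp [inv_def, hC_det]
  have h_conj : (A⁻¹ * C⁻¹ ^ 2 * B * C ^ 2 * A ^ 2).trace
      = (C⁻¹ ^ 2 * B * C ^ 2 * A).trace := by
    have hA_cancel : A ^ 2 * A⁻¹ = A := by
      rw [pow_two, mul_nonsing_inv_cancel_right _ _ (by simp [hA_det])]
    simp only [mul_assoc]
    rw [trace_mul_comm]
    simp only [mul_assoc, hA_cancel]
  rw [h_conj, hC_inv, trace_adjugate_sq_mul_mul_sq_mul, hC_det, ha, hb, hc, hx, hy, hz, hd]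
  ring
end

section
/- For every real number t, the linear map L_t : ℝ² → ℝ² given by L_t(η, ζ) = (-η - tζ, tη + (t² - 1)ζ) preserves the quadratic form q_t(η, ζ) = η² + ζ² + t·ηζ (i.e., q_t(L_t(η,ζ)) = q_t(η,ζ) for all η, ζ), has determinant 1 and trace t² - 2; consequently, for t ∈ (-2, 2), L_t is conjugate in GL(2, ℝ) to the rotation of ℝ² by the angle 2·arccos(t/2). -/
open Matrix

/-- The linear map `L_t(η, ζ) = (-η - tζ, tη + (t² - 1)ζ)` preserves the quadratic form
`q_t(η, ζ) = η² + ζ² + tηζ`, has determinant `1` and trace `t² - 2`; for `t ∈ (-2, 2)` it is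
conjugate in `GL(2, ℝ)` to the rotation by the angle `2 · arccos (t/2)`. -/
theorem twist_matrix_is_rotation (t : ℝ) :
    (∀ η ζ : ℝ,
      (-η - t * ζ) ^ 2 + (t * η + (t ^ 2 - 1) * ζ) ^ 2
          + t * ((-η - t * ζ) * (t * η + (t ^ 2 - 1) * ζ))
        = η ^ 2 + ζ ^ 2 + t * (η * ζ)) ∧
    (!![-1, -t; t, t ^ 2 - 1] : Matrix (Fin 2) (Fin 2) ℝ).det = 1 ∧
    (!![-1, -t; t, t ^ 2 - 1] : Matrix (Fin 2) (Fin 2) ℝ).trace = t ^ 2 - 2 ∧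
    (t ∈ Set.Ioo (-2 : ℝ) 2 →
      ∃ g : GL (Fin 2) ℝ,
        (!![-1, -t; t, t ^ 2 - 1] : Matrix (Fin 2) (Fin 2) ℝ) =
          (g : Matrix (Fin 2) (Fin 2) ℝ) *
            !![Real.cos (2 * Real.arccos (t / 2)), -Real.sin (2 * Real.arccos (t / 2));
               Real.sin (2 * Real.arccos (t / 2)), Real.cos (2 * Real.arccos (t / 2))] *
            ((g⁻¹ : GL (Fin 2) ℝ) : Matrix (Fin 2) (Fin 2) ℝ)) := by
  refine ⟨fun η ζ => by ring, ?_, ?_, fun ⟨h₁, h₂⟩ => ?_⟩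
  · rw [det_fin_two_of]
    ring
  · rw [trace_fin_two_of]
    ring
  set θ := Real.arccos (t / 2)
  have hcos : t = 2 * Real.cos θ := by
    rw [Real.cos_arccos (by linarith) (by linarith)]
    ring
  have hsin : 0 < Real.sin θ :=
    Real.sin_pos_of_pos_of_lt_pi (Real.arccos_pos.2 (by linarith))
      (Real.arccos_lt_pi.2 (by linarith))
  have hdet : (!![Real.sin θ, -Real.cos θ; 0, 1] : Matrix (Fin 2) (Fin 2) ℝ).det ≠ 0 := by
    simpa [det_fin_two_of] using hsin.ne'
  refine ⟨GeneralLinearGroup.mkOfDetNeZero _ hdet, (Units.eq_mul_inv_iff_mul_eq _).2 ?_⟩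
  change _ * !![Real.sin θ, -Real.cos θ; 0, 1] = !![Real.sin θ, -Real.cos θ; 0, 1] * _
  have hsq := Real.sin_sq_add_cos_sq θ
  rw [Real.cos_two_mul, Real.sin_two_mul, hcos]
  ext i j
  fin_cases i <;> fin_cases j <;> simp <;> grind
end
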